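/- Let N be a positive integer and p a prime with p ∤ N, and let Γ = Γ^para(N) ⊂ GL(4, ℚ). Then the two double cosets Γ · diag(p, 1, p, p²) · Γ and Γ · diag(1, p, p², p) · Γ coincide; that is, {γ₁ diag(p,1,p,p²) γ₂ : γ₁, γ₂ ∈ Γ} = {γ₁ diag(1,p,p²,p) γ₂ : γ₁, γ₂ ∈ Γ} as subsets of GL(4, ℚ). -/

import Mathlib

open Matrix

/-- The standard symplectic matrix `J = [[0, 1₂], [−1₂, 0]]` in 2×2 block form. -/
def Jmat : Matrix (Fin 4) (Fin 4) ℚ :=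
  !![0, 0, 1, 0;
     0, 0, 0, 1;
     -1, 0, 0, 0;
     0, -1, 0, 0]

/-- Membership in the paramodular group `Γ^para(N)`: `g ∈ Sp(4, ℚ)` (i.e.
`gᵀ J g = J`) together with the integrality conditions
`g₁₂, g₃₂, g₄₁, g₄₂, g₄₃ ∈ Nℤ`, `g₂₄ ∈ N⁻¹ℤ`, and all remaining entries in `ℤ`. -/
def ParaMem (N : ℕ) (g : Matrix (Fin 4) (Fin 4) ℚ) : Prop :=
  gᵀ * Jmat * g = Jmat ∧
  (∃ a : ℤ, g 0 1 = N * a) ∧ (∃ a : ℤ, g 2 1 = N * a) ∧ (∃ a : ℤ, g 3 0 = N * a) ∧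
  (∃ a : ℤ, g 3 1 = N * a) ∧ (∃ a : ℤ, g 3 2 = N * a) ∧
  (∃ a : ℤ, g 1 3 = a / N) ∧
  (∃ a : ℤ, g 0 0 = a) ∧ (∃ a : ℤ, g 0 2 = a) ∧ (∃ a : ℤ, g 0 3 = a) ∧
  (∃ a : ℤ, g 1 0 = a) ∧ (∃ a : ℤ, g 1 1 = a) ∧ (∃ a : ℤ, g 1 2 = a) ∧
  (∃ a : ℤ, g 2 0 = a) ∧ (∃ a : ℤ, g 2 2 = a) ∧ (∃ a : ℤ, g 2 3 = a) ∧
  (∃ a : ℤ, g 3 3 = a)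

/-- The paramodular group is closed under multiplication. -/
theorem ParaMem.mul {N : ℕ} (hN : 0 < N) {g h : Matrix (Fin 4) (Fin 4) ℚ}
    (hg : ParaMem N g) (hh : ParaMem N h) : ParaMem N (g * h) := by
  obtain ⟨hJ, ⟨a01, h01⟩, ⟨a21, h21⟩, ⟨a30, h30⟩, ⟨a31, h31⟩, ⟨a32, h32⟩, ⟨a13, h13⟩, ⟨a00, h00⟩,
    ⟨a02, h02⟩, ⟨a03, h03⟩, ⟨a10, h10⟩, ⟨a11, h11⟩, ⟨a12, h12⟩, ⟨a20, h20⟩, ⟨a22, h22⟩, ⟨a23,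
    h23⟩, ⟨a33, h33⟩⟩ := hg
  obtain ⟨kJ, ⟨b01, k01⟩, ⟨b21, k21⟩, ⟨b30, k30⟩, ⟨b31, k31⟩, ⟨b32, k32⟩, ⟨b13, k13⟩, ⟨b00, k00⟩,
    ⟨b02, k02⟩, ⟨b03, k03⟩, ⟨b10, k10⟩, ⟨b11, k11⟩, ⟨b12, k12⟩, ⟨b20, k20⟩, ⟨b22, k22⟩, ⟨b23,
    k23⟩, ⟨b33, k33⟩⟩ := hh
  have hN' : (N : ℚ) ≠ 0 := by exact_mod_cast hN.ne'
  refine ⟨?_,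
    ⟨a00 * b01 + a01 * b11 + a02 * b21 + a03 * b31, ?_⟩,
    ⟨a20 * b01 + a21 * b11 + a22 * b21 + a23 * b31, ?_⟩,
    ⟨a30 * b00 + a31 * b10 + a32 * b20 + a33 * b30, ?_⟩,
    ⟨N * a30 * b01 + a31 * b11 + N * a32 * b21 + a33 * b31, ?_⟩,
    ⟨a30 * b02 + a31 * b12 + a32 * b22 + a33 * b32, ?_⟩,
    ⟨N * a10 * b03 + a11 * b13 + N * a12 * b23 + a13 * b33, ?_⟩,
    ⟨a00 * b00 + N * a01 * b10 + a02 * b20 + N * a03 * b30, ?_⟩,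
    ⟨a00 * b02 + N * a01 * b12 + a02 * b22 + N * a03 * b32, ?_⟩,
    ⟨a00 * b03 + a01 * b13 + a02 * b23 + a03 * b33, ?_⟩,
    ⟨a10 * b00 + a11 * b10 + a12 * b20 + a13 * b30, ?_⟩,
    ⟨N * a10 * b01 + a11 * b11 + N * a12 * b21 + a13 * b31, ?_⟩,
    ⟨a10 * b02 + a11 * b12 + a12 * b22 + a13 * b32, ?_⟩,
    ⟨a20 * b00 + N * a21 * b10 + a22 * b20 + N * a23 * b30, ?_⟩,
    ⟨a20 * b02 + N * a21 * b12 + a22 * b22 + N * a23 * b32, ?_⟩,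
    ⟨a20 * b03 + a21 * b13 + a22 * b23 + a23 * b33, ?_⟩,
    ⟨N * a30 * b03 + a31 * b13 + N * a32 * b23 + a33 * b33, ?_⟩⟩
  · calc (g * h)ᵀ * Jmat * (g * h) = hᵀ * (gᵀ * Jmat * g) * h := by
          simp only [transpose_mul, Matrix.mul_assoc]
      _ = Jmat := by rw [hJ, kJ]
  all_goals
    simp only [mul_apply, Fin.sum_univ_four,
      h01, h21, h30, h31, h32, h13, h00, h02, h03, h10, h11, h12, h20, h22, h23, h33,
      k01, k21, k30, k31, k32, k13, k00, k02, k03, k10, k11, k12, k20, k22, k23, k33]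
    push_cast
    field_simp

/-- The block-diagonal symplectic matrix `diag(A, A⁻ᵀ)` attached to `A = [[a, N b], [c, d]]`
of determinant one. -/
def paraLevi (N : ℕ) (a b c d : ℤ) : Matrix (Fin 4) (Fin 4) ℚ :=
  !![(a : ℚ), N * b, 0, 0;
     (c : ℚ), d, 0, 0;
     0, 0, (d : ℚ), -c;
     0, 0, -(N * b : ℚ), a]

theorem paraMem_paraLevi {N : ℕ} {a b c d : ℤ} (h : a * d - N * b * c = 1) :
    ParaMem N (paraLevi N a b c d) := by
  have h' : (a * d - N * b * c : ℚ) = 1 := by exact_mod_cast h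
  refine ⟨?_, ⟨b, ?_⟩, ⟨0, ?_⟩, ⟨0, ?_⟩, ⟨0, ?_⟩, ⟨-b, ?_⟩, ⟨0, ?_⟩, ⟨a, ?_⟩, ⟨0, ?_⟩, ⟨0, ?_⟩,
    ⟨c, ?_⟩, ⟨d, ?_⟩, ⟨0, ?_⟩, ⟨0, ?_⟩, ⟨d, ?_⟩, ⟨-c, ?_⟩, ⟨a, ?_⟩⟩
  · ext i j
    fin_cases i <;> fin_cases j <;>
      simp [paraLevi, Jmat, mul_apply, Fin.sum_univ_four] <;> linarith
  all_goals simp [paraLevi]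

theorem diagonal_eq_paraLevi_mul {N : ℕ} {p a b : ℤ} (h : p * a - N * b = 1) :
    diagonal ![(p : ℚ), 1, p, (p : ℚ) ^ 2] =
      paraLevi N p (-b) (-1) a * diagonal ![1, (p : ℚ), (p : ℚ) ^ 2, p] *
        paraLevi N (p * a) b 1 1 := by
  have h' : (N * b : ℚ) = p * a - 1 := by
    have : (p * a - N * b : ℚ) = 1 := by exact_mod_cast h
    linarith
  ext i j
  fin_cases i <;> fin_cases j <;>
    simp [paraLevi, mul_apply, Fin.sum_univ_four, vecMul_diagonal, h'] <;> ring

theorem diagonal_eq_paraLevi_mul' {N : ℕ} {p a b : ℤ} (h : p * a - N * b = 1) :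
    diagonal ![1, (p : ℚ), (p : ℚ) ^ 2, p] =
      paraLevi N a b 1 p * diagonal ![(p : ℚ), 1, p, (p : ℚ) ^ 2] *
        paraLevi N 1 (-b) (-1) (p * a) := by
  have h' : (N * b : ℚ) = p * a - 1 := by
    have : (p * a - N * b : ℚ) = 1 := by exact_mod_cast h
    linarith
  ext i j
  fin_cases i <;> fin_cases j <;>
    simp [paraLevi, mul_apply, Fin.sum_univ_four, vecMul_diagonal, h'] <;> ring

/-- Let `N` be a positive integer and `p` a prime with `p ∤ N`. Then the double cosets
`Γ^para(N) diag(p,1,p,p²) Γ^para(N)` and `Γ^para(N) diag(1,p,p²,p) Γ^para(N)`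
coincide as subsets of `GL(4, ℚ)`. -/
theorem paramodular_double_cosets_eq (N p : ℕ) (hN : 0 < N) (hp : p.Prime)
    (hpN : ¬ p ∣ N) :
    {m : Matrix (Fin 4) (Fin 4) ℚ | ∃ γ₁ γ₂, ParaMem N γ₁ ∧ ParaMem N γ₂ ∧
        m = γ₁ * Matrix.diagonal ![(p : ℚ), 1, (p : ℚ), (p : ℚ) ^ 2] * γ₂} =
    {m : Matrix (Fin 4) (Fin 4) ℚ | ∃ γ₁ γ₂, ParaMem N γ₁ ∧ ParaMem N γ₂ ∧
        m = γ₁ * Matrix.diagonal ![1, (p : ℚ), (p : ℚ) ^ 2, (p : ℚ)] * γ₂} := by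
  obtain ⟨a, b, hab⟩ : ∃ a b : ℤ, (p : ℤ) * a - N * b = 1 := by
    obtain ⟨u, v, huv⟩ :=
      Nat.isCoprime_iff_coprime.mpr ((Nat.Prime.coprime_iff_not_dvd hp).mpr hpN)
    exact ⟨u, -v, by linarith⟩
  have h₁ := diagonal_eq_paraLevi_mul hab
  have h₂ := diagonal_eq_paraLevi_mul' hab
  simp only [Int.cast_natCast] at h₁ h₂
  ext m
  constructor
  · rintro ⟨γ₁, γ₂, hγ₁, hγ₂, rfl⟩
    refine ⟨γ₁ * paraLevi N p (-b) (-1) a, paraLevi N (p * a) b 1 1 * γ₂,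
      hγ₁.mul hN (paraMem_paraLevi (by linarith)),
      (paraMem_paraLevi (by linarith)).mul hN hγ₂, ?_⟩
    rw [h₁]
    simp only [Matrix.mul_assoc]
  · rintro ⟨γ₁, γ₂, hγ₁, hγ₂, rfl⟩
    refine ⟨γ₁ * paraLevi N a b 1 p, paraLevi N 1 (-b) (-1) (p * a) * γ₂,
      hγ₁.mul hN (paraMem_paraLevi (by linarith)),
      (paraMem_paraLevi (by linarith)).mul hN hγ₂, ?_⟩
    rw [h₂]
    simp only [Matrix.mul_assoc]
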